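/- In the setting of the GMRES residual formula, if additionally the columns of Q_{k+1} are orthonormal, then ‖r_k‖ = ‖β e_1 − H̃_k z‖; consequently, minimizing ‖b − A(x_0 + Q_k z)‖ over z ∈ ℝ^k is equivalent to solving the least-squares problem H̃_k z ≈ β e_1, i.e., min_{z ∈ ℝ^k} ‖b − A(x_0 + Q_k z)‖ = min_{z ∈ ℝ^k} ‖β e_1 − H̃_k z‖. -/

import Mathlib

open Matrix

/-- The Euclidean 2-norm on `Fin m → ℝ`. -/
noncomputable def euclNorm {m : ℕ} (x : Fin m → ℝ) : ℝ := Real.sqrt (∑ i, x i ^ 2)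

theorem euclNorm_eq_sqrt_dotProduct {m : ℕ} (x : Fin m → ℝ) :
    euclNorm x = Real.sqrt (x ⬝ᵥ x) := by
  simp only [euclNorm, dotProduct, sq]

theorem euclNorm_ne_zero {m : ℕ} {x : Fin m → ℝ} (hx : x ≠ 0) : euclNorm x ≠ 0 := by
  rw [euclNorm_eq_sqrt_dotProduct]
  exact (Real.sqrt_pos.2 (lt_of_le_of_ne
    (Finset.sum_nonneg fun i _ => mul_self_nonneg (x i))
    (fun h => hx (dotProduct_self_eq_zero.1 h.symm)))).ne'

/-- A matrix with orthonormal columns preserves the Euclidean norm. -/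
theorem euclNorm_mulVec_of_transpose_mul_self {n m : ℕ} {Q : Matrix (Fin n) (Fin m) ℝ}
    (hQ : Qᵀ * Q = 1) (y : Fin m → ℝ) : euclNorm (Q *ᵥ y) = euclNorm y := by
  rw [euclNorm_eq_sqrt_dotProduct, euclNorm_eq_sqrt_dotProduct, dotProduct_mulVec,
    ← mulVec_transpose, mulVec_mulVec, hQ, one_mulVec]

/-- In the GMRES setting, if the columns of `Q_{k+1}` are orthonormal, then
`‖r_k‖ = ‖β e_1 − H̃_k z‖` for every `z`, and minimizing `‖b − A(x_0 + Q_k z)‖` over `z`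
is equivalent to the least-squares problem `H̃_k z ≈ β e_1`. -/
theorem gmres_least_squares (n k : ℕ) (A : Matrix (Fin n) (Fin n) ℝ)
    (b x0 r0 : Fin n → ℝ) (hr0 : r0 = b - A.mulVec x0) (hne : r0 ≠ 0)
    (β : ℝ) (hβ : β = euclNorm r0)
    (Q : Matrix (Fin n) (Fin (k + 1)) ℝ)
    (hq1 : (fun i => Q i 0) = β⁻¹ • r0)
    (horth : Qᵀ * Q = 1)
    (H : Matrix (Fin (k + 1)) (Fin k) ℝ)
    (hrel : A * Q.submatrix id Fin.castSucc = Q * H) :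
    (∀ z : Fin k → ℝ,
      euclNorm (b - A.mulVec (x0 + (Q.submatrix id Fin.castSucc).mulVec z))
        = euclNorm (β • (Pi.single 0 1 : Fin (k + 1) → ℝ) - H.mulVec z)) ∧
    sInf (Set.range fun z : Fin k → ℝ =>
        euclNorm (b - A.mulVec (x0 + (Q.submatrix id Fin.castSucc).mulVec z)))
      = sInf (Set.range fun z : Fin k → ℝ =>
        euclNorm (β • (Pi.single 0 1 : Fin (k + 1) → ℝ) - H.mulVec z)) := by
  have residual_eq (z : Fin k → ℝ) :
      b - A *ᵥ (x0 + Q.submatrix id Fin.castSucc *ᵥ z)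
        = Q *ᵥ (β • (Pi.single 0 1 : Fin (k + 1) → ℝ) - H *ᵥ z) := by
    have hβ0 : β ≠ 0 := hβ ▸ euclNorm_ne_zero hne
    have hcol : Q *ᵥ Pi.single 0 1 = β⁻¹ • r0 := by
      rw [mulVec_single_one]
      exact hq1
    rw [mulVec_sub, mulVec_smul, hcol, smul_inv_smul₀ hβ0, hr0, mulVec_add, mulVec_mulVec,
      mulVec_mulVec, hrel, sub_add_eq_sub_sub]
  have norm_eq (z : Fin k → ℝ) :
      euclNorm (b - A *ᵥ (x0 + Q.submatrix id Fin.castSucc *ᵥ z))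
        = euclNorm (β • (Pi.single 0 1 : Fin (k + 1) → ℝ) - H *ᵥ z) := by
    rw [residual_eq, euclNorm_mulVec_of_transpose_mul_self horth]
  exact ⟨norm_eq, by simp only [norm_eq]⟩
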